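/- Let c > 0 and x⁰ ∈ ℝ^n, let ŷ⁰ be a minimizer of F(y; x⁰) = Σ_i H_c(x⁰_i − y), and suppose that |x⁰_i − ŷ⁰| ≠ c for every i and that I = {i : |x⁰_i − ŷ⁰| < c} is nonempty. Then there exist an open neighborhood U of x⁰ and a function ŷ : U → ℝ with ŷ(x⁰) = ŷ⁰ such that for every x ∈ U, ŷ(x) minimizes y ↦ Σ_i H_c(x_i − y), and ŷ is differentiable at x⁰ with partial derivatives ∂ŷ/∂x_i (x⁰) = 1/|I| if i ∈ I and ∂ŷ/∂x_i (x⁰) = 0 otherwise. -/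

import Mathlib

/-- The Huber loss with parameter `c`. -/
noncomputable def huber (c x : ℝ) : ℝ :=
  if |x| ≤ c then x ^ 2 / 2 else c * (|x| - c / 2)

/-- The derivative of the Huber loss: the projection of `u` onto `[-c, c]`. -/
noncomputable def huberScore (c u : ℝ) : ℝ := max (-c) (min c u)

lemma huberScore_of_abs_le {c u : ℝ} (h : |u| ≤ c) : huberScore c u = u := by
  obtain ⟨h1, h2⟩ := abs_le.mp h
  rw [huberScore, min_eq_right h2, max_eq_right h1]

lemma huberScore_of_le {c u : ℝ} (hc : 0 ≤ c) (h : c ≤ u) : huberScore c u = c := by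
  rw [huberScore, min_eq_left h, max_eq_right (by linarith)]

lemma huberScore_of_le_neg {c u : ℝ} (h : u ≤ -c) : huberScore c u = -c :=
  max_eq_left (le_trans (min_le_right _ _) h)

/-- Off the threshold, the score is locally either the identity or constant. -/
lemma huberScore_sub_of_abs_sub_lt {c u v : ℝ} (hc : 0 ≤ c)
    (h : |v - u| < |(|u| - c)|) :
    huberScore c v - huberScore c u = if |u| < c then v - u else 0 := by
  split_ifs with hu
  · rw [abs_of_neg (sub_neg.mpr hu)] at h
    have hv := abs_sub_abs_le_abs_sub v u
    rw [huberScore_of_abs_le hu.le, huberScore_of_abs_le (by linarith)]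
  · rw [abs_of_nonneg (a := |u| - c) (by linarith)] at h
    obtain ⟨h1, h2⟩ := abs_lt.mp h
    rcases le_total 0 u with h0 | h0
    · rw [abs_of_nonneg h0] at hu h1
      rw [huberScore_of_le hc (by linarith), huberScore_of_le hc (by linarith), sub_self]
    · rw [abs_of_nonpos h0] at hu h2
      rw [huberScore_of_le_neg (by linarith), huberScore_of_le_neg (by linarith), sub_self]

lemma huber_eq_score {c : ℝ} (hc : 0 ≤ c) (u : ℝ) :
    huber c u = huberScore c u * u - huberScore c u ^ 2 / 2 := by
  unfold huber
  split_ifs with h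
  · rw [huberScore_of_abs_le h]; ring
  · rcases le_total 0 u with h0 | h0
    · rw [abs_of_nonneg h0] at h ⊢
      rw [huberScore_of_le hc (by linarith)]; ring
    · rw [abs_of_nonpos h0] at h ⊢
      rw [huberScore_of_le_neg (by linarith)]; ring

lemma abs_huberScore_le {c : ℝ} (hc : 0 ≤ c) (u : ℝ) : |huberScore c u| ≤ c :=
  abs_le.mpr ⟨le_max_left _ _, max_le (by linarith) (min_le_left _ _)⟩

/-- The Huber loss is the conjugate of `s ↦ s ^ 2 / 2` restricted to `[-c, c]`. -/
lemma mul_sub_sq_le_huber {c s : ℝ} (hs : |s| ≤ c) (v : ℝ) :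
    s * v - s ^ 2 / 2 ≤ huber c v := by
  unfold huber
  split_ifs with h
  · nlinarith [sq_nonneg (s - v)]
  · have h1 : s * v ≤ |s| * |v| := by rw [← abs_mul]; exact le_abs_self _
    rw [← sq_abs s]
    nlinarith [mul_nonneg (sub_nonneg.mpr hs) (sub_nonneg.mpr (not_le.mp h).le),
      sq_nonneg (c - |s|)]

/-- The subgradient inequality for the Huber loss. -/
lemma huber_add_score_mul_le {c : ℝ} (hc : 0 ≤ c) (u v : ℝ) :
    huber c u + huberScore c u * (v - u) ≤ huber c v := by
  have h := mul_sub_sq_le_huber (abs_huberScore_le hc u) v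
  rw [huber_eq_score hc u]
  linarith

/-- The quadratic upper bound expressing that the Huber score is `1`-Lipschitz. -/
lemma huber_le_add_score_mul {c : ℝ} (hc : 0 ≤ c) (u v : ℝ) :
    huber c v ≤ huber c u + huberScore c u * (v - u) + (v - u) ^ 2 / 2 := by
  have key : (huberScore c v - huberScore c u) * (u - huberScore c u) ≤ 0 := by
    obtain ⟨h1, h2⟩ := abs_le.mp (abs_huberScore_le hc v)
    rcases le_or_gt |u| c with h | h
    · rw [huberScore_of_abs_le h]; simp
    · rcases lt_abs.mp h with h0 | h0
      · rw [huberScore_of_le (u := u) hc h0.le]; nlinarith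
      · rw [huberScore_of_le_neg (u := u) (by linarith)]; nlinarith
  rw [huber_eq_score hc u, huber_eq_score hc v]
  nlinarith [sq_nonneg (huberScore c v - huberScore c u - (v - u))]

section Sums

variable {ι : Type*} [Fintype ι] {c : ℝ}

lemma sum_huber_sub_le_of_sum_score_eq_zero (hc : 0 ≤ c) {x : ι → ℝ} {z : ℝ}
    (h : ∑ i, huberScore c (x i - z) = 0) (y : ℝ) :
    ∑ i, huber c (x i - z) ≤ ∑ i, huber c (x i - y) := by
  have hsum := Finset.sum_le_sum fun i (_ : i ∈ Finset.univ) =>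
    huber_add_score_mul_le hc (x i - z) (x i - y)
  simpa [Finset.sum_add_distrib, ← Finset.sum_mul, h] using hsum

lemma sum_score_eq_zero_of_minimizer (hc : 0 ≤ c) {x : ι → ℝ} {z : ℝ}
    (h : ∀ y, ∑ i, huber c (x i - z) ≤ ∑ i, huber c (x i - y)) :
    ∑ i, huberScore c (x i - z) = 0 := by
  cases isEmpty_or_nonempty ι
  · simp
  set S := ∑ i, huberScore c (x i - z) with hS
  set N : ℝ := (Fintype.card ι : ℝ) with hNdef
  have hN : 0 < N := Nat.cast_pos.mpr Fintype.card_pos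
  have hsum := Finset.sum_le_sum fun i (_ : i ∈ Finset.univ) =>
    huber_le_add_score_mul hc (x i - z) (x i - (z + S / N))
  have h1 := (h (z + S / N)).trans hsum
  simp only [sub_sub_sub_cancel_left, sub_add_cancel_left, Finset.sum_add_distrib,
    ← Finset.sum_mul, Finset.sum_const, Finset.card_univ, nsmul_eq_mul, ← hS, ← hNdef] at h1
  have h2 : S * -(S / N) + N * ((-(S / N)) ^ 2 / 2) = -(S ^ 2 / (2 * N)) := by
    field_simp; ring
  have h3 : S ^ 2 / (2 * N) ≤ 0 := by
    linarith
  have h4 : S ^ 2 ≤ 0 := by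
    by_contra! hpos
    exact absurd h3 (not_le.mpr (by positivity))
  exact pow_eq_zero_iff two_ne_zero |>.mp (le_antisymm h4 (sq_nonneg S))

end Sums

/-- If `y0` minimizes `y ↦ ∑ i, H_c (x0 i - y)` with `|x0 i - y0| ≠ c`
for all `i` and `I = {i : |x0 i - y0| < c}` nonempty, then on a neighborhood `U` of `x0`
there is a selection `ŷ` of minimizers with `ŷ x0 = y0` which is differentiable at `x0`
with gradient `1/|I|` on the coordinates in `I` and `0` elsewhere. -/
theorem huber_estimator_differentiable
    (n : ℕ) (c : ℝ) (hc : 0 < c) (x0 : Fin n → ℝ) (y0 : ℝ)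
    (hmin : ∀ y : ℝ, ∑ i, huber c (x0 i - y0) ≤ ∑ i, huber c (x0 i - y))
    (hnc : ∀ i, |x0 i - y0| ≠ c)
    (I : Finset (Fin n)) (hI : I = Finset.univ.filter fun i => |x0 i - y0| < c)
    (hIne : I.Nonempty) :
    ∃ (U : Set (Fin n → ℝ)) (yhat : (Fin n → ℝ) → ℝ),
      IsOpen U ∧ x0 ∈ U ∧ yhat x0 = y0 ∧
      (∀ x ∈ U, ∀ y : ℝ, ∑ i, huber c (x i - yhat x) ≤ ∑ i, huber c (x i - y)) ∧
      HasFDerivAt yhat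
        ((I.card : ℝ)⁻¹ •
          ∑ i ∈ I, (ContinuousLinearMap.proj i : (Fin n → ℝ) →L[ℝ] ℝ)) x0 := by
  set L : (Fin n → ℝ) →L[ℝ] ℝ := (I.card : ℝ)⁻¹ •
    ∑ i ∈ I, (ContinuousLinearMap.proj i : (Fin n → ℝ) →L[ℝ] ℝ) with hL
  have hcard : (I.card : ℝ) ≠ 0 := by simpa using hIne.ne_empty
  have hLapp (x : Fin n → ℝ) : I.card * L x = ∑ i ∈ I, x i := by
    simp [hL, mul_inv_cancel_left₀ hcard]
  let yhat : (Fin n → ℝ) → ℝ := fun x => y0 + L (x - x0)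
  have hcont : Continuous yhat := by fun_prop
  refine ⟨{x | ∀ i, |x i - yhat x - (x0 i - y0)| < |(|x0 i - y0| - c)|}, yhat,
    ?_, fun i => ?_, by simp [yhat], fun x hx => ?_, ?_⟩
  · simp only [Set.ofPred_forall]
    exact isOpen_iInter_of_finite fun i => isOpen_lt (by fun_prop) continuous_const
  · simpa [yhat, sub_eq_zero] using hnc i
  · apply sum_huber_sub_le_of_sum_score_eq_zero hc.le
    have hdiff := Finset.sum_congr rfl fun i (_ : i ∈ Finset.univ) =>
      huberScore_sub_of_abs_sub_lt hc.le (hx i)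
    rw [Finset.sum_sub_distrib, sum_score_eq_zero_of_minimizer hc.le hmin, sub_zero,
      ← Finset.sum_filter, ← hI] at hdiff
    have hLx := hLapp (x - x0)
    simp only [Pi.sub_apply, Finset.sum_sub_distrib] at hLx
    rw [hdiff]
    simp only [yhat, Finset.sum_sub_distrib, Finset.sum_const, nsmul_eq_mul]
    linarith
  · exact (L.hasFDerivAt.comp x0 ((hasFDerivAt_id x0).sub_const x0)).const_add y0
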